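/- Let H : ℝ^{2n} → ℝ be continuously differentiable and let g(τ|x₀) be its Hamiltonian flow. Define the extended Hamiltonian ℋ₁ : ℝ^{4n} → ℝ by ℋ₁(x,y) = H(x - (1/2)Jy). Then for any z₀ = (x₀,y₀) ∈ ℝ^{4n}, with l₀ = x₀ - (1/2)Jy₀ and r₀ = x₀ + (1/2)Jy₀, the curve G(τ) = (x(τ), y(τ)) given by x(τ) = (1/2)(g(τ|l₀) + r₀) and y(τ) = J(g(τ|l₀) - r₀) solves the extended Hamiltonian system dG/dτ = J̃∇ℋ₁(G(τ)) with G(0) = z₀ (on the time interval on which g(·|l₀) is defined). -/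

import Mathlib

open Matrix MeasureTheory

noncomputable section

abbrev Vec (n : ℕ) := Fin (2*n) → ℝ

/-- The `2n×2n` symplectic matrix `J = [[0, Iₙ], [-Iₙ, 0]]`. -/
def symJ (n : ℕ) : Matrix (Fin (2*n)) (Fin (2*n)) ℝ :=
  Matrix.of fun i j =>
    if i.val < n ∧ j.val = i.val + n then 1
    else if j.val < n ∧ i.val = j.val + n then -1 else 0

/-- Gradient of a scalar function on `ℝ^m`, as the vector of partial derivatives. -/
def grad {m : ℕ} (f : (Fin m → ℝ) → ℝ) (x : Fin m → ℝ) : Fin m → ℝ :=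
  fun i => fderiv ℝ f x (Pi.single i 1)

/-- Primary Poisson bracket `{f,g}₁(x) = ∇f(x) · J ∇g(x)`. -/
def pb1 (n : ℕ) (f g : Vec n → ℝ) (x : Vec n) : ℝ :=
  grad f x ⬝ᵥ (symJ n).mulVec (grad g x)

/-- `x`-gradient of a function on secondary phase space `ℝ^{2n} × ℝ^{2n}`. -/
def grad2x (n : ℕ) (F : Vec n × Vec n → ℝ) (z : Vec n × Vec n) : Vec n :=
  fun i => fderiv ℝ F z (Pi.single i 1, 0)

/-- `y`-gradient of a function on secondary phase space `ℝ^{2n} × ℝ^{2n}`. -/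
def grad2y (n : ℕ) (F : Vec n × Vec n → ℝ) (z : Vec n × Vec n) : Vec n :=
  fun i => fderiv ℝ F z (0, Pi.single i 1)

/-- Secondary Poisson bracket `{F,G}₂(z) = ∇F(z) · J̃ ∇G(z)` with
`J̃ = [[0, I_{2n}], [-I_{2n}, 0]]`, i.e. `∇ₓF·∇_yG - ∇_yF·∇ₓG`. -/
def pb2 (n : ℕ) (F G : Vec n × Vec n → ℝ) (z : Vec n × Vec n) : ℝ :=
  grad2x n F z ⬝ᵥ grad2y n G z - grad2y n F z ⬝ᵥ grad2x n G z

/-- Left projection `l(x,y) = x - (1/2) J y`. -/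
def lmap (n : ℕ) (z : Vec n × Vec n) : Vec n := z.1 - (1/2 : ℝ) • (symJ n).mulVec z.2

/-- Right projection `r(x,y) = x + (1/2) J y`. -/
def rmap (n : ℕ) (z : Vec n × Vec n) : Vec n := z.1 + (1/2 : ℝ) • (symJ n).mulVec z.2

/-- Hessian matrix of a scalar function on `ℝ^m`. -/
def hess {m : ℕ} (f : (Fin m → ℝ) → ℝ) (x : Fin m → ℝ) : Matrix (Fin m) (Fin m) ℝ :=
  Matrix.of fun i j => fderiv ℝ (fun y => fderiv ℝ f y (Pi.single j 1)) x (Pi.single i 1)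

/-- Jacobian matrix of a map `ℝ^m → ℝ^m`. -/
def jac {m : ℕ} (f : (Fin m → ℝ) → (Fin m → ℝ)) (x : Fin m → ℝ) :
    Matrix (Fin m) (Fin m) ℝ :=
  Matrix.of fun i j => fderiv ℝ f x (Pi.single j 1) i

/-- Operator norm of a matrix acting on Euclidean space `ℝ^m`. -/
def opNorm {m : ℕ} (A : Matrix (Fin m) (Fin m) ℝ) : ℝ :=
  ‖Matrix.toEuclideanCLM (𝕜 := ℝ) A‖

/-- Symplectic pairing `x ∧ y = x · J y`. -/
def wedgeP (n : ℕ) (x y : Vec n) : ℝ := x ⬝ᵥ (symJ n).mulVec y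

theorem symJ_transpose (n : ℕ) : (symJ n)ᵀ = -symJ n := by
  ext i j
  simp only [symJ, Matrix.transpose_apply, Matrix.of_apply, Matrix.neg_apply]
  split_ifs <;> first | omega | simp

theorem symJ_mulVec_apply (n : ℕ) (v : Vec n) (i : Fin (2*n)) :
    (symJ n).mulVec v i = if h : i.val < n then v ⟨i.val + n, by omega⟩
      else -v ⟨i.val - n, by omega⟩ := by
  simp only [Matrix.mulVec, dotProduct]
  split_ifs with h
  · rw [Finset.sum_eq_single (⟨i.val + n, by omega⟩ : Fin (2*n))]
    · simp [symJ, h]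
    · intro b _ hb
      have hb' : b.val ≠ i.val + n := fun e => hb (Fin.ext e)
      have h2 : ¬ (b.val < n ∧ i.val = b.val + n) := by omega
      simp [symJ, hb', h2]
    · simp
  · have hi := i.isLt
    rw [Finset.sum_eq_single (⟨i.val - n, by omega⟩ : Fin (2*n))]
    · have h1 : i.val - n < n ∧ i.val = i.val - n + n := by omega
      simp only [symJ, Matrix.of_apply, h, false_and, if_false, if_pos h1]
      ring
    · intro b _ hb
      have hb' : b.val ≠ i.val - n := fun e => hb (Fin.ext e)
      have h2 : ¬ (b.val < n ∧ i.val = b.val + n) := by omega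
      simp [symJ, h, h2]
    · simp

theorem symJ_mulVec_mulVec (n : ℕ) (v : Vec n) :
    (symJ n).mulVec ((symJ n).mulVec v) = -v := by
  ext i
  have hi := i.isLt
  rw [symJ_mulVec_apply]
  split_ifs with h
  · rw [symJ_mulVec_apply, dif_neg (by simp)]
    simp
  · rw [symJ_mulVec_apply, dif_pos (by simp; omega)]
    simp only [Pi.neg_apply]
    congr 2
    ext
    simp
    omega

theorem fderiv_eq_grad_dotProduct {m : ℕ} (f : (Fin m → ℝ) → ℝ) (x v : Fin m → ℝ) :
    fderiv ℝ f x v = grad f x ⬝ᵥ v := by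
  conv_lhs => rw [pi_eq_sum_univ' v]
  simp [grad, dotProduct, mul_comm]

def lCLM (n : ℕ) : (Vec n × Vec n) →L[ℝ] Vec n :=
  ContinuousLinearMap.fst ℝ _ _ -
    (1/2 : ℝ) • ((Matrix.mulVecLin (symJ n)).toContinuousLinearMap.comp
      (ContinuousLinearMap.snd ℝ _ _))

theorem lCLM_apply (n : ℕ) (z : Vec n × Vec n) : lCLM n z = lmap n z := by
  simp [lCLM, lmap]

theorem fderiv_ext (n : ℕ) (H : Vec n → ℝ) (hH : ContDiff ℝ 1 H) (z v : Vec n × Vec n) :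
    fderiv ℝ (fun z => H (lmap n z)) z v = grad H (lmap n z) ⬝ᵥ lmap n v := by
  have h1 : HasFDerivAt H (fderiv ℝ H (lCLM n z)) (lCLM n z) :=
    (hH.differentiable (by norm_num) _).hasFDerivAt
  have h2 := (h1.comp z (lCLM n).hasFDerivAt).fderiv
  have h3 : (fun z => H (lmap n z)) = H ∘ lCLM n := by
    funext z
    simp [lCLM_apply]
  rw [h3, h2, ContinuousLinearMap.comp_apply, lCLM_apply, lCLM_apply,
    fderiv_eq_grad_dotProduct]

theorem grad2x_ext (n : ℕ) (H : Vec n → ℝ) (hH : ContDiff ℝ 1 H) (z : Vec n × Vec n) :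
    grad2x n (fun z => H (lmap n z)) z = grad H (lmap n z) := by
  ext i
  rw [grad2x, fderiv_ext n H hH]
  simp [lmap]

theorem grad2y_ext (n : ℕ) (H : Vec n → ℝ) (hH : ContDiff ℝ 1 H) (z : Vec n × Vec n) :
    grad2y n (fun z => H (lmap n z)) z
      = (1/2 : ℝ) • (symJ n).mulVec (grad H (lmap n z)) := by
  ext i
  rw [grad2y, fderiv_ext n H hH]
  have : (symJ n).mulVec (grad H (lmap n z)) = -(grad H (lmap n z) ᵥ* symJ n) := by
    rw [← Matrix.mulVec_transpose, symJ_transpose, Matrix.neg_mulVec, neg_neg]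
  rw [this]
  simp [lmap]
  rfl

/-- for the Schrödinger extended Hamiltonian `ℋ₁(x,y) = H(x - (1/2)Jy)`,
the curve `G(τ) = ((1/2)(g(τ|l₀) + r₀), J(g(τ|l₀) - r₀))` solves the extended Hamiltonian
system `dG/dτ = J̃∇ℋ₁(G(τ))` with `G(0) = (x₀,y₀)`.  (Here `J̃∇ℋ₁(z) = (∇_yℋ₁(z), -∇_xℋ₁(z))`.) -/
theorem stmt3 (n : ℕ) (H : Vec n → ℝ) (hH : ContDiff ℝ 1 H)
    (g : ℝ → Vec n → Vec n)
    (hg0 : ∀ x₀, g 0 x₀ = x₀)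
    (hgflow : ∀ x₀ τ, HasDerivAt (fun s => g s x₀) ((symJ n).mulVec (grad H (g τ x₀))) τ)
    (x₀ y₀ : Vec n) :
    let H₁ : Vec n × Vec n → ℝ := fun z => H (lmap n z)
    let l₀ : Vec n := x₀ - (1/2 : ℝ) • (symJ n).mulVec y₀
    let r₀ : Vec n := x₀ + (1/2 : ℝ) • (symJ n).mulVec y₀
    let G : ℝ → Vec n × Vec n := fun τ =>
      ((1/2 : ℝ) • (g τ l₀ + r₀), (symJ n).mulVec (g τ l₀ - r₀))
    G 0 = (x₀, y₀) ∧
    ∀ τ, HasDerivAt G (grad2y n H₁ (G τ), -(grad2x n H₁ (G τ))) τ := by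
  intro H₁ l₀ r₀ G
  have hlG : ∀ τ, lmap n (G τ) = g τ l₀ := by
    intro τ
    simp only [lmap, G, symJ_mulVec_mulVec]
    module
  refine ⟨?_, fun τ => ?_⟩
  · simp only [G, hg0]
    refine Prod.ext ?_ ?_
    · simp only [l₀, r₀]
      module
    · have : l₀ - r₀ = -(symJ n).mulVec y₀ := by
        simp only [l₀, r₀]
        module
      simp only [this, Matrix.mulVec_neg, symJ_mulVec_mulVec, neg_neg]
  · have hy : grad2y n H₁ (G τ) = (1/2 : ℝ) • (symJ n).mulVec (grad H (g τ l₀)) := by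
      rw [grad2y_ext n H hH, hlG]
    have hx : grad2x n H₁ (G τ) = grad H (g τ l₀) := by
      rw [grad2x_ext n H hH, hlG]
    rw [hx, hy]
    have hd := hgflow l₀ τ
    refine HasDerivAt.prodMk ?_ ?_
    · exact (hd.add_const r₀).const_smul (1/2 : ℝ)
    · have h := ((Matrix.mulVecLin (symJ n)).toContinuousLinearMap.hasFDerivAt
        (x := g τ l₀ - r₀)).comp_hasDerivAt τ (hd.sub_const r₀)
      have e : (Matrix.mulVecLin (symJ n)).toContinuousLinearMap
          ((symJ n).mulVec (grad H (g τ l₀))) = -grad H (g τ l₀) := by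
        exact symJ_mulVec_mulVec n _
      rw [e] at h
      exact h
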